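/- The function \bar I_{α,M} is continuous on [0,∞); in particular it is continuous at 0, i.e., lim_{γ→0⁺} \bar I_{α,M}(γ) = \bar I_{α,M}(0). -/

import Mathlib

open Real BigOperators Filter

noncomputable section

/-- Base-2 Shannon entropy of a probability vector on a finite alphabet. -/
def shEnt {I : Type} [Fintype I] (P : I → ℝ) : ℝ := -∑ i, P i * Real.logb 2 (P i)

/-- Rényi entropy of order `α` (base 2) of a probability vector. -/
def renyiEnt {I : Type} [Fintype I] (α : ℝ) (P : I → ℝ) : ℝ :=
  (1 - α)⁻¹ * Real.logb 2 (∑ i, P i ^ α)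

open Classical in
/-- Entropy of order `α`, where `α = 1` is understood as Shannon entropy. -/
def entOrd {I : Type} [Fintype I] (α : ℝ) (P : I → ℝ) : ℝ :=
  if α = 1 then shEnt P else renyiEnt α P

/-- `p` is a joint pmf on `Y × X`. -/
def IsJointPmf {Y X : Type} [Fintype Y] [Fintype X] (p : Y → X → ℝ) : Prop :=
  (∀ y x, 0 ≤ p y x) ∧ ∑ y, ∑ x, p y x = 1

/-- `q` is a channel (conditional pmf) from `X` to `W`. -/
def IsKernel {X W : Type} [Fintype X] [Fintype W] (q : X → W → ℝ) : Prop :=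
  (∀ x w, 0 ≤ q x w) ∧ ∀ x, ∑ w, q x w = 1

def margX {Y X : Type} [Fintype Y] [Fintype X] (p : Y → X → ℝ) (x : X) : ℝ := ∑ y, p y x

def margY {Y X : Type} [Fintype Y] [Fintype X] (p : Y → X → ℝ) (y : Y) : ℝ := ∑ x, p y x

/-- Marginal of `W` when `W` is generated from `X` through the channel `q`. -/
def margW {Y X W : Type} [Fintype Y] [Fintype X] [Fintype W]
    (p : Y → X → ℝ) (q : X → W → ℝ) (w : W) : ℝ := ∑ x, margX p x * q x w

/-- Joint pmf of `(Y, W)` under the Markov chain `Y - X - W`. -/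
def jointYW {Y X W : Type} [Fintype Y] [Fintype X] [Fintype W]
    (p : Y → X → ℝ) (q : X → W → ℝ) (y : Y) (w : W) : ℝ := ∑ x, p y x * q x w

/-- Joint pmf of `(X, W)`. -/
def jointXW {Y X W : Type} [Fintype Y] [Fintype X] [Fintype W]
    (p : Y → X → ℝ) (q : X → W → ℝ) (x : X) (w : W) : ℝ := margX p x * q x w

/-- Mutual information (base 2) of a joint pmf on `A × B`. -/
def mi2 {A B : Type} [Fintype A] [Fintype B] (r : A → B → ℝ) : ℝ :=
  shEnt (fun a => ∑ b, r a b) + shEnt (fun b => ∑ a, r a b)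
    - shEnt (fun ab : A × B => r ab.1 ab.2)

/-- `I(Y;W)` under the Markov chain `Y - X - W`. -/
def miYW {Y X W : Type} [Fintype Y] [Fintype X] [Fintype W]
    (p : Y → X → ℝ) (q : X → W → ℝ) : ℝ := mi2 (jointYW p q)

/-- `I(Y;X)`. -/
def miYX {Y X : Type} [Fintype Y] [Fintype X] (p : Y → X → ℝ) : ℝ := mi2 p

/-- `I(X;W)`. -/
def miXW {Y X W : Type} [Fintype Y] [Fintype X] [Fintype W]
    (p : Y → X → ℝ) (q : X → W → ℝ) : ℝ := mi2 (jointXW p q)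

/-- The bottleneck function `F_{α,M}(γ)`: maximal relevance `I(Y;W)` over channels
`P_{W|X}` with output alphabet of size (at most) `M` satisfying `H_α(W) ≤ γ`. -/
def Ffun {Y X : Type} [Fintype Y] [Fintype X] (p : Y → X → ℝ) (M : ℕ) (α γ : ℝ) : ℝ :=
  sSup {v | ∃ q : X → Fin M → ℝ, IsKernel q ∧ entOrd α (margW p q) ≤ γ ∧ v = miYW p q}

/-- Upper concave envelope on `[0,∞)` via two-point convex combinations. -/
def env (F : ℝ → ℝ) (γ : ℝ) : ℝ :=
  sSup {v | ∃ t γ₁ γ₂ : ℝ, 0 ≤ t ∧ t ≤ 1 ∧ 0 ≤ γ₁ ∧ 0 ≤ γ₂ ∧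
    t * γ₁ + (1 - t) * γ₂ = γ ∧ v = t * F γ₁ + (1 - t) * F γ₂}

/-- The information bottleneck function `\bar I_IB(r)`. -/
def IBfun {Y X : Type} [Fintype Y] [Fintype X] (p : Y → X → ℝ) (r : ℝ) : ℝ :=
  sSup {v | ∃ (m : ℕ) (q : X → Fin m → ℝ), IsKernel q ∧ miXW p q ≤ r ∧ v = miYW p q}

/-- The i.i.d. joint pmf of `(Yⁿ, Xⁿ)`. -/
def iidP {Y X : Type} [Fintype Y] [Fintype X] (p : Y → X → ℝ) (n : ℕ)
    (yn : Fin n → Y) (xn : Fin n → X) : ℝ := ∏ i, p (yn i) (xn i)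

open Classical in
/-- Joint pmf of `(Y_i, W_i)` when `Wⁿ` is produced from `Xⁿ` by the (possibly randomized)
code `Q` and `(Yⁿ, Xⁿ)` is i.i.d. with per-letter law `p`. -/
def pairYW {Y X W : Type} [Fintype Y] [Fintype X] [Fintype W]
    (p : Y → X → ℝ) (n : ℕ) (Q : (Fin n → X) → (Fin n → W) → ℝ) (i : Fin n)
    (y : Y) (w : W) : ℝ :=
  ∑ yn : Fin n → Y, ∑ xn : Fin n → X, ∑ wn : Fin n → W,
    iidP p n yn xn * Q xn wn * (if yn i = y ∧ wn i = w then 1 else 0)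

/-- Average per-letter output Rényi entropy `γ_n = (1/n) ∑ H_α(W_i)` of a code. -/
def avgRenyi {Y X W : Type} [Fintype Y] [Fintype X] [Fintype W]
    (p : Y → X → ℝ) (n : ℕ) (Q : (Fin n → X) → (Fin n → W) → ℝ) (α : ℝ) : ℝ :=
  (1 / (n : ℝ)) * ∑ i : Fin n, renyiEnt α (fun w => ∑ y, pairYW p n Q i y w)

/-- Average per-letter relevance `η_n = (1/n) ∑ I(Y_i; W_i)` of a code. -/
def avgRel {Y X W : Type} [Fintype Y] [Fintype X] [Fintype W]
    (p : Y → X → ℝ) (n : ℕ) (Q : (Fin n → X) → (Fin n → W) → ℝ) : ℝ :=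
  (1 / (n : ℝ)) * ∑ i : Fin n, mi2 (pairYW p n Q i)

/-- A Rényi entropy-relevance pair `(γ, η)` is achievable if some sequence of
(possibly randomized) codes `Φⁿ : 𝒳ⁿ → 𝒲ⁿ`, `|𝒲| ≤ M`, has
`limsup γ_n ≤ γ` and `liminf η_n ≥ η`. -/
def Achievable {Y X : Type} [Fintype Y] [Fintype X]
    (p : Y → X → ℝ) (M : ℕ) (α γ η : ℝ) : Prop :=
  ∃ Q : (n : ℕ) → (Fin n → X) → (Fin n → Fin M) → ℝ,
    (∀ n, IsKernel (Q n)) ∧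
    Filter.limsup (fun n => avgRenyi p n (Q n) α) Filter.atTop ≤ γ ∧
    η ≤ Filter.liminf (fun n => avgRel p n (Q n)) Filter.atTop

/-- The achievable Rényi entropy-relevance region: the closure of all achievable pairs. -/
def Region {Y X : Type} [Fintype Y] [Fintype X]
    (p : Y → X → ℝ) (M : ℕ) (α : ℝ) : Set (ℝ × ℝ) :=
  closure {z : ℝ × ℝ | 0 ≤ z.1 ∧ 0 ≤ z.2 ∧ Achievable p M α z.1 z.2}

/-- `I_{α,M}(γ)`: the maximal achievable relevance at Rényi entropy cost `γ`. -/
def Irel {Y X : Type} [Fintype Y] [Fintype X]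
    (p : Y → X → ℝ) (M : ℕ) (α γ : ℝ) : ℝ :=
  sSup {η | (γ, η) ∈ Region p M α}


/-- A nonnegative joint mass function has entropy at least that of its first marginal. -/
lemma shEnt_marginal_le {A B : Type} [Fintype A] [Fintype B] (r : A → B → ℝ)
    (hr : ∀ a b, 0 ≤ r a b) :
    shEnt (fun a => ∑ b, r a b) ≤ shEnt (fun ab : A × B => r ab.1 ab.2) := by
  unfold shEnt
  rw [Fintype.sum_prod_type]
  refine neg_le_neg (Finset.sum_le_sum fun a _ => ?_)
  rw [Finset.sum_mul]
  refine Finset.sum_le_sum fun b _ => ?_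
  rcases (hr a b).eq_or_lt with h | h
  · simp [← h]
  · have hle : r a b ≤ ∑ b, r a b :=
      Finset.single_le_sum (fun b _ => hr a b) (Finset.mem_univ b)
    exact mul_le_mul_of_nonneg_left (Real.logb_le_logb_of_le one_lt_two h hle) h.le

lemma mi2_le_shEnt {A B : Type} [Fintype A] [Fintype B] (r : A → B → ℝ)
    (hr : ∀ a b, 0 ≤ r a b) : mi2 r ≤ shEnt (fun b => ∑ a, r a b) := by
  have := shEnt_marginal_le r hr
  unfold mi2
  linarith

/-- Shannon entropy is at most the Rényi entropy of any order in `(0, 1)`. -/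
lemma shEnt_le_renyiEnt {I : Type} [Fintype I] (P : I → ℝ) (hP : ∀ i, 0 ≤ P i)
    (hsum : ∑ i, P i = 1) {α : ℝ} (hα0 : 0 < α) (hα1 : α < 1) :
    shEnt P ≤ renyiEnt α P := by
  set S := ∑ i, P i ^ α with hS
  have hSpos : 0 < S := by
    obtain ⟨i, -, hi⟩ : ∃ i ∈ Finset.univ, P i ≠ 0 :=
      Finset.exists_ne_zero_of_sum_ne_zero (by rw [hsum]; exact one_ne_zero)
    exact Finset.sum_pos' (fun i _ => Real.rpow_nonneg (hP i) α)
      ⟨i, Finset.mem_univ i, Real.rpow_pos_of_pos ((hP i).lt_of_ne' hi) α⟩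
  have hterm : ∀ i, (α - 1) * (P i * Real.log (P i)) ≤
      P i ^ α / S - P i + P i * Real.log S := by
    intro i
    rcases (hP i).eq_or_lt with h | h
    · simp [← h, Real.zero_rpow hα0.ne']
    · have h1 := Real.log_le_sub_one_of_pos (div_pos (Real.rpow_pos_of_pos h (α - 1)) hSpos)
      rw [Real.log_div (Real.rpow_pos_of_pos h _).ne' hSpos.ne', Real.log_rpow h] at h1
      have h2 := mul_le_mul_of_nonneg_left h1 h.le
      have h3 : P i * (P i ^ (α - 1) / S) = P i ^ α / S := by
        rw [Real.rpow_sub_one h.ne']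
        field_simp
      linarith
  have hlog : (1 - α) * -∑ i, P i * Real.log (P i) ≤ Real.log S := by
    have h := Finset.sum_le_sum fun i (_ : i ∈ Finset.univ) => hterm i
    rw [← Finset.mul_sum, Finset.sum_add_distrib, Finset.sum_sub_distrib, ← Finset.sum_div,
      ← Finset.sum_mul, hsum, ← hS, div_self hSpos.ne'] at h
    linarith
  have hsh : shEnt P = (-∑ i, P i * Real.log (P i)) / Real.log 2 := by
    simp only [shEnt, Real.logb, ← mul_div_assoc, ← Finset.sum_div, neg_div]
  have h1α : 0 < 1 - α := by linarith
  rw [renyiEnt, ← hS, hsh, Real.logb, ← mul_div_assoc]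
  refine div_le_div_of_nonneg_right ?_ (Real.log_nonneg one_le_two)
  rwa [le_inv_mul_iff₀ h1α]

lemma shEnt_le_entOrd {I : Type} [Fintype I] (P : I → ℝ) (hP : ∀ i, 0 ≤ P i)
    (hsum : ∑ i, P i = 1) {α : ℝ} (hα0 : 0 < α) (hα1 : α ≤ 1) :
    shEnt P ≤ entOrd α P := by
  unfold entOrd
  split_ifs with h
  · exact le_rfl
  · exact shEnt_le_renyiEnt P hP hsum hα0 (lt_of_le_of_ne hα1 h)

lemma sum_jointYW {Y X W : Type} [Fintype Y] [Fintype X] [Fintype W]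
    (p : Y → X → ℝ) (q : X → W → ℝ) (w : W) : ∑ y, jointYW p q y w = margW p q w := by
  simp only [jointYW, margW, margX, Finset.sum_mul]
  exact Finset.sum_comm

lemma sum_margW {Y X W : Type} [Fintype Y] [Fintype X] [Fintype W]
    {p : Y → X → ℝ} (hp : IsJointPmf p) {q : X → W → ℝ} (hq : IsKernel q) :
    ∑ w, margW p q w = 1 := by
  simp only [margW]
  rw [Finset.sum_comm]
  simp only [← Finset.mul_sum, hq.2, mul_one, margX]
  rw [Finset.sum_comm, hp.2]

lemma miYW_le_entOrd {Y X W : Type} [Fintype Y] [Fintype X] [Fintype W]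
    {p : Y → X → ℝ} (hp : IsJointPmf p) {q : X → W → ℝ} (hq : IsKernel q)
    {α : ℝ} (hα0 : 0 < α) (hα1 : α ≤ 1) : miYW p q ≤ entOrd α (margW p q) := by
  have hj : ∀ y w, 0 ≤ jointYW p q y w := fun y w =>
    Finset.sum_nonneg fun x _ => mul_nonneg (hp.1 y x) (hq.1 x w)
  have h := mi2_le_shEnt (jointYW p q) hj
  simp only [sum_jointYW] at h
  refine h.trans (shEnt_le_entOrd _ (fun w => ?_) (sum_margW hp hq) hα0 hα1)
  rw [← sum_jointYW]
  exact Finset.sum_nonneg fun y _ => hj y w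

/-- The channel with constant output `w₀`. -/
def constKernel (X : Type) {W : Type} [DecidableEq W] (w₀ : W) (_ : X) (w : W) : ℝ :=
  if w = w₀ then 1 else 0

lemma isKernel_constKernel (X : Type) {W : Type} [Fintype X] [Fintype W] [DecidableEq W]
    (w₀ : W) : IsKernel (constKernel X w₀) := by
  refine ⟨fun x w => ?_, fun x => by simp [constKernel]⟩
  unfold constKernel
  split_ifs <;> norm_num

lemma margW_constKernel {Y X W : Type} [Fintype Y] [Fintype X] [Fintype W] [DecidableEq W]
    {p : Y → X → ℝ} (hp : IsJointPmf p) (w₀ : W) :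
    margW p (constKernel X w₀) = fun w => if w = w₀ then 1 else 0 := by
  funext w
  simp only [margW, constKernel, ← Finset.sum_mul, margX]
  rw [Finset.sum_comm, hp.2, one_mul]

lemma shEnt_ite_eq {W : Type} [Fintype W] [DecidableEq W] (w₀ : W) :
    shEnt (fun w => if w = w₀ then (1 : ℝ) else 0) = 0 := by
  simp [shEnt]

lemma entOrd_ite_eq {W : Type} [Fintype W] [DecidableEq W] (w₀ : W) {α : ℝ} (hα0 : 0 < α) :
    entOrd α (fun w => if w = w₀ then (1 : ℝ) else 0) = 0 := by
  unfold entOrd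
  split_ifs with h
  · exact shEnt_ite_eq w₀
  · simp [renyiEnt, Real.zero_rpow hα0.ne', apply_ite (fun x : ℝ => x ^ α)]

lemma miYW_constKernel {Y X W : Type} [Fintype Y] [Fintype X] [Fintype W] [DecidableEq W]
    {p : Y → X → ℝ} (hp : IsJointPmf p) (w₀ : W) : miYW p (constKernel X w₀) = 0 := by
  have hj : ∀ y w, jointYW p (constKernel X w₀) y w = if w = w₀ then margY p y else 0 := by
    intro y w
    simp [jointYW, constKernel, margY]
  have hW : (fun w => ∑ y, jointYW p (constKernel X w₀) y w) =
      fun w => if w = w₀ then 1 else 0 := by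
    simp only [sum_jointYW]
    exact margW_constKernel hp w₀
  rw [miYW, mi2, hW, shEnt_ite_eq]
  simp [hj, shEnt, Fintype.sum_prod_type]

lemma Ffun_nonneg {Y X : Type} [Fintype Y] [Fintype X] {p : Y → X → ℝ} (hp : IsJointPmf p)
    {M : ℕ} (hM : 0 < M) {α γ : ℝ} (hα0 : 0 < α) (hα1 : α ≤ 1) (hγ : 0 ≤ γ) :
    0 ≤ Ffun p M α γ := by
  refine le_csSup ⟨γ, ?_⟩ ⟨constKernel X ⟨0, hM⟩, isKernel_constKernel X _, ?_,
    (miYW_constKernel hp _).symm⟩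
  · rintro v ⟨q, hq, hqγ, rfl⟩
    exact (miYW_le_entOrd hp hq hα0 hα1).trans hqγ
  · rwa [margW_constKernel hp, entOrd_ite_eq _ hα0]

lemma Ffun_le {Y X : Type} [Fintype Y] [Fintype X] {p : Y → X → ℝ} (hp : IsJointPmf p)
    (M : ℕ) {α γ : ℝ} (hα0 : 0 < α) (hα1 : α ≤ 1) (hγ : 0 ≤ γ) :
    Ffun p M α γ ≤ γ := by
  refine Real.sSup_le ?_ hγ
  rintro v ⟨q, hq, hqγ, rfl⟩
  exact (miYW_le_entOrd hp hq hα0 hα1).trans hqγ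

/-- The envelope is below every affine majorant of the function on `[0, ∞)`. -/
lemma env_le_affine {F : ℝ → ℝ} {c s γ : ℝ} (hF : ∀ y, 0 ≤ y → F y ≤ c + s * y)
    (hγ : 0 ≤ γ) : env F γ ≤ c + s * γ := by
  refine csSup_le ⟨_, 1, γ, γ, zero_le_one, le_rfl, hγ, hγ, by ring, rfl⟩ ?_
  rintro v ⟨t, a, b, ht0, ht1, ha, hb, rfl, rfl⟩
  have h1 := mul_le_mul_of_nonneg_left (hF a ha) ht0
  have h2 := mul_le_mul_of_nonneg_left (hF b hb) (sub_nonneg.2 ht1)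
  linarith

lemma le_env {F : ℝ → ℝ} {c s : ℝ} (hF : ∀ y, 0 ≤ y → F y ≤ c + s * y) {t a b : ℝ}
    (ht0 : 0 ≤ t) (ht1 : t ≤ 1) (ha : 0 ≤ a) (hb : 0 ≤ b) :
    t * F a + (1 - t) * F b ≤ env F (t * a + (1 - t) * b) := by
  refine le_csSup ⟨c + s * (t * a + (1 - t) * b), ?_⟩ ⟨t, a, b, ht0, ht1, ha, hb, rfl, rfl⟩
  rintro v ⟨t', a', b', ht0', ht1', ha', hb', heq, rfl⟩
  have h1 := mul_le_mul_of_nonneg_left (hF a' ha') ht0'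
  have h2 := mul_le_mul_of_nonneg_left (hF b' hb') (sub_nonneg.2 ht1')
  rw [← heq]
  linarith

/-- The function has an affine majorant touching its two-point envelope at any interior point. -/
lemma exists_affine_majorant_eq_env {F : ℝ → ℝ} {c s : ℝ}
    (hF : ∀ y, 0 ≤ y → F y ≤ c + s * y) {x : ℝ} (hx : 0 < x) :
    ∃ k, ∀ y, 0 ≤ y → F y ≤ env F x + k * (y - x) := by
  have hchord : ∀ a b, 0 ≤ a → a < x → x < b →
      (F b - env F x) / (b - x) ≤ (env F x - F a) / (x - a) := by
    intro a b ha hax hxb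
    have hab : 0 < b - a := by linarith
    have h := le_env hF (t := (b - x) / (b - a)) (a := a) (b := b)
      (div_nonneg (by linarith) hab.le) ((div_le_one hab).2 (by linarith)) ha (by linarith)
    have hpt : (b - x) / (b - a) * a + (1 - (b - x) / (b - a)) * b = x := by
      field_simp
      ring
    have hval : (b - x) / (b - a) * F a + (1 - (b - x) / (b - a)) * F b =
        ((b - x) * F a + (x - a) * F b) / (b - a) := by
      field_simp
      ring
    rw [hpt, hval, div_le_iff₀ hab] at h
    rw [div_le_div_iff₀ (by linarith) (by linarith)]
    linarith
  let T : Set ℝ := (fun b => (F b - env F x) / (b - x)) '' Set.Ioi x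
  have hT : ∀ a, 0 ≤ a → a < x → (env F x - F a) / (x - a) ∈ upperBounds T := by
    rintro a ha hax _ ⟨b, hb, rfl⟩
    exact hchord a b ha hax hb
  refine ⟨sSup T, fun y hy => ?_⟩
  rcases lt_trichotomy y x with h | rfl | h
  · have hle := csSup_le (Set.nonempty_Ioi.image _) (hT y hy h)
    rw [le_div_iff₀ (by linarith)] at hle
    linarith
  · have := le_env hF zero_le_one le_rfl hy hy
    simpa using this
  · have hle := le_csSup ⟨_, hT 0 le_rfl hx⟩ (Set.mem_image_of_mem _ (Set.mem_Ioi.2 h))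
    rw [div_le_iff₀ (by linarith)] at hle
    linarith

lemma concaveOn_env {F : ℝ → ℝ} {c s : ℝ} (hF : ∀ y, 0 ≤ y → F y ≤ c + s * y) :
    ConcaveOn ℝ (Set.Ioi 0) (env F) := by
  refine ⟨convex_Ioi 0, fun a ha b hb t u ht hu htu => ?_⟩
  have hz : 0 < t • a + u • b := convex_Ioi (0 : ℝ) ha hb ht hu htu
  obtain ⟨k, hk⟩ := exists_affine_majorant_eq_env hF hz
  set z := t • a + u • b with hzdef
  have hline : ∀ y, 0 ≤ y → env F y ≤ (env F z - k * z) + k * y := fun y hy =>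
    env_le_affine (fun w hw => (hk w hw).trans_eq (by ring)) hy
  have h1 := mul_le_mul_of_nonneg_left (hline a (le_of_lt ha)) ht
  have h2 := mul_le_mul_of_nonneg_left (hline b (le_of_lt hb)) hu
  simp only [smul_eq_mul] at hzdef ⊢
  have h3 : t * (env F z - k * z + k * a) + u * (env F z - k * z + k * b) = env F z := by
    have : t * (env F z - k * z + k * a) + u * (env F z - k * z + k * b) =
        (t + u) * (env F z - k * z) + k * (t * a + u * b) := by ring
    rw [this, htu, ← hzdef]
    ring
  linarith

/-- The envelope of a function lying between `0` and the identity is continuous on `[0, ∞)`. -/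
lemma continuousOn_env {F : ℝ → ℝ} (hF0 : ∀ y, 0 ≤ y → 0 ≤ F y) (hF : ∀ y, 0 ≤ y → F y ≤ y) :
    ContinuousOn (env F) (Set.Ici 0) := by
  have hF' : ∀ y, 0 ≤ y → F y ≤ 0 + 1 * y := fun y hy => by simpa using hF y hy
  have hle : ∀ y, 0 ≤ y → env F y ≤ y := fun y hy => by simpa using env_le_affine hF' hy
  have hge : ∀ y, 0 ≤ y → 0 ≤ env F y := fun y hy =>
    (hF0 y hy).trans (by simpa using le_env hF' zero_le_one le_rfl hy hy)
  intro x hx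
  rcases (Set.mem_Ici.1 hx).eq_or_lt with rfl | hpos
  · have h0 : env F 0 = 0 := le_antisymm (hle 0 le_rfl) (hge 0 le_rfl)
    rw [ContinuousWithinAt, h0]
    refine tendsto_of_tendsto_of_tendsto_of_le_of_le' tendsto_const_nhds
      (tendsto_id.mono_left nhdsWithin_le_nhds) ?_ ?_
    · filter_upwards [self_mem_nhdsWithin] with y hy using hge y hy
    · filter_upwards [self_mem_nhdsWithin] with y hy using hle y hy
  · exact (((concaveOn_env hF').continuousOn isOpen_Ioi).continuousAt
      (Ioi_mem_nhds hpos)).continuousWithinAt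

/-- `\bar I_{α,M}` is continuous on `[0,∞)`; in particular it is continuous
at `0` from the right: `lim_{γ→0⁺} \bar I_{α,M}(γ) = \bar I_{α,M}(0)`. -/
theorem stmt5 {Y X : Type} [Fintype Y] [Fintype X]
    (p : Y → X → ℝ) (hp : IsJointPmf p)
    (M : ℕ) (hM : 0 < M) (α : ℝ) (hα0 : 0 < α) (hα1 : α ≤ 1) :
    ContinuousOn (env (Ffun p M α)) (Set.Ici (0 : ℝ)) ∧
    Filter.Tendsto (env (Ffun p M α)) (nhdsWithin 0 (Set.Ioi (0 : ℝ)))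
      (nhds (env (Ffun p M α) 0)) := by
  have hcont := continuousOn_env (F := Ffun p M α)
    (fun _ hy => Ffun_nonneg hp hM hα0 hα1 hy) (fun _ hy => Ffun_le hp M hα0 hα1 hy)
  exact ⟨hcont, (hcont 0 Set.self_mem_Ici).mono_left (nhdsWithin_mono 0 Set.Ioi_subset_Ici_self)⟩

end
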